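/- arXiv:2010.08048 — 2 statements merged into one kernel-verified Lean document; each statement's English description precedes it below -/
import Mathlib

section
/- Let J ≥ 1 and let a_1,…,a_J ∈ (0,1] and b_1,…,b_J ∈ [0,1]. Then |∏_{j=1}^{J} b_j − ∏_{j=1}^{J} a_j| ≤ Σ_{j=1}^{J} ((∏_{i=1}^{J} a_i)/a_j)·|a_j − b_j| + Σ_{(i,j): i≠j} |a_i − b_i|·|a_j − b_j|, where the second sum ranges over ordered pairs (i,j) with i ≠ j. -/
open Finset

theorem abs_prod_sub_prod_le_sum {ι : Type*} (s : Finset ι) {a b : ι → ℝ}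
    (ha : ∀ j, a j ∈ Set.Icc (0 : ℝ) 1) (hb : ∀ j, b j ∈ Set.Icc (0 : ℝ) 1) :
    |∏ j ∈ s, b j - ∏ j ∈ s, a j| ≤ ∑ j ∈ s, |a j - b j| := by
  classical
  induction s using Finset.induction_on with
  | empty => simp
  | insert k s hk ih =>
    rw [prod_insert hk, prod_insert hk, sum_insert hk]
    have hA0 : 0 ≤ ∏ j ∈ s, a j := prod_nonneg fun j _ => (ha j).1
    have hA1 : ∏ j ∈ s, a j ≤ 1 := prod_le_one (fun j _ => (ha j).1) fun j _ => (ha j).2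
    calc |b k * ∏ j ∈ s, b j - a k * ∏ j ∈ s, a j|
        = |(b k - a k) * ∏ j ∈ s, a j + b k * (∏ j ∈ s, b j - ∏ j ∈ s, a j)| := by ring_nf
      _ ≤ |b k - a k| * ∏ j ∈ s, a j + b k * |∏ j ∈ s, b j - ∏ j ∈ s, a j| := by
        refine (abs_add_le _ _).trans_eq ?_
        rw [abs_mul, abs_mul, abs_of_nonneg hA0, abs_of_nonneg (hb k).1]
      _ ≤ |a k - b k| + ∑ j ∈ s, |a j - b j| := by
        rw [abs_sub_comm (b k)]
        exact add_le_add (mul_le_of_le_one_right (abs_nonneg _) hA1)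
          ((mul_le_of_le_one_left (abs_nonneg _) (hb k).2).trans ih)

theorem mul_sum_add_sum_offDiag_le {ι : Type*} [DecidableEq ι] {s : Finset ι} {k : ι}
    (hk : k ∉ s) {d : ι → ℝ} (hd : ∀ j, 0 ≤ d j) :
    d k * ∑ j ∈ s, d j + ∑ p ∈ s.offDiag, d p.1 * d p.2 ≤
      ∑ p ∈ (insert k s).offDiag, d p.1 * d p.2 := by
  have hdisj : Disjoint ({k} ×ˢ s) s.offDiag := by
    rw [Finset.disjoint_left]
    rintro ⟨i, j⟩ hi hj
    simp only [mem_product, mem_singleton, mem_offDiag] at hi hj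
    exact hk (hi.1 ▸ hj.1)
  have hsum : ∑ p ∈ {k} ×ˢ s, d p.1 * d p.2 = d k * ∑ j ∈ s, d j := by
    rw [sum_product, sum_singleton, mul_sum]
  rw [← hsum, ← sum_union hdisj]
  refine sum_le_sum_of_subset_of_nonneg ?_ fun p _ _ => mul_nonneg (hd _) (hd _)
  rw [offDiag_insert hk]
  grind

theorem abs_prod_sub_prod_le_sum_add_sum_offDiag {ι : Type*} [DecidableEq ι] (s : Finset ι)
    {a b : ι → ℝ} (ha : ∀ j, a j ∈ Set.Ioc (0 : ℝ) 1) (hb : ∀ j, b j ∈ Set.Icc (0 : ℝ) 1) :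
    |∏ j ∈ s, b j - ∏ j ∈ s, a j| ≤
      (∑ j ∈ s, (∏ i ∈ s, a i) / a j * |a j - b j|) +
        ∑ p ∈ s.offDiag, |a p.1 - b p.1| * |a p.2 - b p.2| := by
  induction s using Finset.induction_on with
  | empty => simp
  | insert k s hk ih =>
    have hcross := mul_sum_add_sum_offDiag_le hk (d := fun j => |a j - b j|)
      fun j => abs_nonneg _
    have hlip := abs_prod_sub_prod_le_sum s (fun j => Set.Ioc_subset_Icc_self (ha j)) hb
    have hoff : 0 ≤ ∑ p ∈ s.offDiag, |a p.1 - b p.1| * |a p.2 - b p.2| :=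
      sum_nonneg fun p _ => by positivity
    have hscale : ∑ j ∈ s, (a k * ∏ i ∈ s, a i) / a j * |a j - b j| =
        a k * ∑ j ∈ s, (∏ i ∈ s, a i) / a j * |a j - b j| := by
      rw [mul_sum]
      exact sum_congr rfl fun j _ => by ring
    rw [prod_insert hk, prod_insert hk, sum_insert hk, hscale,
      mul_div_cancel_left₀ _ (ha k).1.ne']
    set A := ∏ j ∈ s, a j
    set B := ∏ j ∈ s, b j
    have hA : 0 ≤ A := prod_nonneg fun j _ => (ha j).1.le
    have htri : |b k * B - a k * A| ≤
        a k * |B - A| + A * |a k - b k| + |a k - b k| * |B - A| := by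
      calc |b k * B - a k * A|
          = |a k * (B - A) + A * (b k - a k) + (b k - a k) * (B - A)| := by ring_nf
        _ ≤ _ := by
          refine (abs_add_three _ _ _).trans_eq ?_
          rw [abs_mul, abs_mul, abs_mul, abs_of_nonneg hA, abs_of_pos (ha k).1,
            abs_sub_comm (b k)]
    have hmain := mul_le_mul_of_nonneg_left ih (ha k).1.le
    have hquad := mul_le_mul_of_nonneg_left hlip (abs_nonneg (a k - b k))
    have hshrink := mul_le_of_le_one_left hoff (ha k).2
    linarith

/-- **Error expansion for funnel conversion probabilities** (deterministic content of
Lemma 2 in the paper). For per-layer probabilities `a j ∈ (0,1]` (estimated) and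
`b j ∈ [0,1]` (true), the error of the product is bounded by the first-order terms
`((∏ a)/a j) * |a j - b j|` plus the sum of the cross products of the per-layer errors
over ordered pairs of distinct indices. -/
theorem product_error_expansion (J : ℕ) (hJ : 1 ≤ J)
    (a b : Fin J → ℝ)
    (ha : ∀ j, a j ∈ Set.Ioc (0 : ℝ) 1)
    (hb : ∀ j, b j ∈ Set.Icc (0 : ℝ) 1) :
    |∏ j, b j - ∏ j, a j| ≤
      (∑ j, (∏ i, a i) / a j * |a j - b j|) +
        ∑ p ∈ Finset.univ.filter (fun p : Fin J × Fin J => p.1 ≠ p.2),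
          |a p.1 - b p.1| * |a p.2 - b p.2| := by
  have hoff : univ.filter (fun p : Fin J × Fin J => p.1 ≠ p.2) = univ.offDiag := by
    ext p
    simp
  rw [hoff]
  exact abs_prod_sub_prod_le_sum_add_sum_offDiag univ ha hb
end

section
/- Let P be a probability distribution on {x ∈ ℝ^d : ‖x‖₂ ≤ d_x}, let μ: ℝ → [0,1] be κ-Lipschitz, and let θ₁*, θ₂* ∈ ℝ^d with ‖θ₁* − θ₂*‖₂ ≤ q. Then the 𝒴-discrepancy under square loss is bounded: sup_{θ ∈ ℝ^d} | E_{x∼P}[(μ(xᵀθ) − μ(xᵀθ₁*))²] − E_{x∼P}[(μ(xᵀθ) − μ(xᵀθ₂*))²] | ≤ 4·κ·d_x·q. -/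
open MeasureTheory Matrix

/-- Cauchy–Schwarz for the dot product of real vectors. -/
theorem abs_dotProduct_le_sqrt_mul_sqrt {ι : Type*} [Fintype ι] (x y : ι → ℝ) :
    |x ⬝ᵥ y| ≤ Real.sqrt (x ⬝ᵥ x) * Real.sqrt (y ⬝ᵥ y) := by
  have hx : 0 ≤ x ⬝ᵥ x := Finset.sum_nonneg fun i _ => mul_self_nonneg (x i)
  rw [← Real.sqrt_mul hx]
  apply Real.abs_le_sqrt
  simpa only [dotProduct, sq] using Finset.sum_mul_sq_le_sq_mul_sq Finset.univ x y

/-- The square loss is `2`-Lipschitz in its target when all values lie in `[0, 1]`. -/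
theorem abs_sq_sub_sub_sq_sub_le {a b c : ℝ} (ha : a ∈ Set.Icc (0 : ℝ) 1)
    (hb : b ∈ Set.Icc (0 : ℝ) 1) (hc : c ∈ Set.Icc (0 : ℝ) 1) :
    |(a - b) ^ 2 - (a - c) ^ 2| ≤ 2 * |b - c| := by
  obtain ⟨ha₀, ha₁⟩ := ha
  obtain ⟨hb₀, hb₁⟩ := hb
  obtain ⟨hc₀, hc₁⟩ := hc
  have h : |b + c - 2 * a| ≤ 2 := abs_le.2 ⟨by linarith, by linarith⟩
  rw [show (a - b) ^ 2 - (a - c) ^ 2 = (b + c - 2 * a) * (b - c) by ring, abs_mul]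
  gcongr

/-- **Discrepancy bound** (Lemma 3 in the appendix of the paper). For a probability
distribution `P` supported on the ball of ℓ²-radius `d_x`, a `κ`-Lipschitz mean
function `μ : ℝ → [0,1]`, and true parameters with `‖θ₁* − θ₂*‖₂ ≤ q`, the
`𝒴`-discrepancy under square loss between the two regression domains is at most
`4 κ d_x q`. -/
theorem discrepancy_bound (d : ℕ) (hd : 1 ≤ d) (dx q κ : ℝ)
    (hdx : 0 < dx) (hq : 0 ≤ q) (hκ : 0 ≤ κ)
    (P : Measure (Fin d → ℝ)) [IsProbabilityMeasure P]
    (hsupp : ∀ᵐ x ∂P, Real.sqrt (x ⬝ᵥ x) ≤ dx)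
    (μ : ℝ → ℝ) (hμrange : ∀ t, μ t ∈ Set.Icc (0 : ℝ) 1)
    (hμlip : ∀ s t, |μ s - μ t| ≤ κ * |s - t|)
    (θ₁ θ₂ : Fin d → ℝ)
    (hθ : Real.sqrt ((θ₁ - θ₂) ⬝ᵥ (θ₁ - θ₂)) ≤ q) :
    ∀ θ : Fin d → ℝ,
      |(∫ x, (μ (x ⬝ᵥ θ) - μ (x ⬝ᵥ θ₁)) ^ 2 ∂P) -
          ∫ x, (μ (x ⬝ᵥ θ) - μ (x ⬝ᵥ θ₂)) ^ 2 ∂P| ≤ 4 * κ * dx * q := by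
  intro θ
  have hμc : Continuous μ :=
    (LipschitzWith.of_dist_le_mul (K := ⟨κ, hκ⟩) fun s t => hμlip s t).continuous
  have hint : ∀ η : Fin d → ℝ, Integrable (fun x => (μ (x ⬝ᵥ θ) - μ (x ⬝ᵥ η)) ^ 2) P := by
    intro η
    have hc : Continuous fun x : Fin d → ℝ => (μ (x ⬝ᵥ θ) - μ (x ⬝ᵥ η)) ^ 2 := by
      simp only [dotProduct]
      fun_prop
    refine Integrable.of_bound hc.aestronglyMeasurable 1 (.of_forall fun x => ?_)
    obtain ⟨h₁, h₂⟩ := hμrange (x ⬝ᵥ θ)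
    obtain ⟨h₃, h₄⟩ := hμrange (x ⬝ᵥ η)
    rw [Real.norm_eq_abs, abs_sq, sq_le_one_iff_abs_le_one, abs_le]
    constructor <;> linarith
  rw [← integral_sub (hint θ₁) (hint θ₂), ← Real.norm_eq_abs]
  have hbound : ∀ᵐ x ∂P, ‖(μ (x ⬝ᵥ θ) - μ (x ⬝ᵥ θ₁)) ^ 2 - (μ (x ⬝ᵥ θ) - μ (x ⬝ᵥ θ₂)) ^ 2‖ ≤
      2 * (κ * (dx * q)) := by
    filter_upwards [hsupp] with x hx
    calc _ ≤ 2 * |μ (x ⬝ᵥ θ₁) - μ (x ⬝ᵥ θ₂)| :=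
          abs_sq_sub_sub_sq_sub_le (hμrange _) (hμrange _) (hμrange _)
      _ ≤ 2 * (κ * |x ⬝ᵥ (θ₁ - θ₂)|) := by
          rw [dotProduct_sub]
          gcongr
          exact hμlip _ _
      _ ≤ 2 * (κ * (dx * q)) := by
          gcongr
          exact (abs_dotProduct_le_sqrt_mul_sqrt x (θ₁ - θ₂)).trans (by gcongr)
  have h := norm_integral_le_of_norm_le_const hbound
  rw [probReal_univ, mul_one] at h
  have : 0 ≤ κ * (dx * q) := by positivity
  linarith
end
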